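/- Suppose b ∈ L¹_loc(ℝ) is locally absolutely continuous with derivative b' ∈ BMO(ℝ). Then there is a constant C > 0 (independent of b) such that for all x ∈ ℝ, |b(x)| / (1 + |x| log⁺|x|) ≤ |b(0)| + C ‖b'‖_*. -/

import Mathlib

open MeasureTheory Set

/-- Average of `f` over the interval `(a,b)`. -/
noncomputable def avgI (f : ℝ → ℝ) (a b : ℝ) : ℝ := (b - a)⁻¹ * ∫ x in a..b, f x

/-- The set of mean oscillations of `f` over bounded intervals. -/
def oscSet (f : ℝ → ℝ) : Set ℝ :=
  {r : ℝ | ∃ a b : ℝ, a < b ∧ r = avgI (fun x => |f x - avgI f a b|) a b}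

/-- The BMO seminorm of `f` (as a supremum of mean oscillations). -/
noncomputable def bmoNorm (f : ℝ → ℝ) : ℝ := sSup (oscSet f)

/-- `f ∈ BMO(ℝ)`: `f` is locally integrable with bounded mean oscillation. -/
def MemBMO (f : ℝ → ℝ) : Prop :=
  MeasureTheory.LocallyIntegrable f MeasureTheory.volume ∧ BddAbove (oscSet f)

/-- The modified norm `‖f‖_* = ‖f‖_BMO + ∫_{[-1,1]} |f|`. -/
noncomputable def starNorm (f : ℝ → ℝ) : ℝ := bmoNorm f + ∫ x in (-1:ℝ)..1, |f x|

/-- The `A_∞` quotient of `w` over the interval `(a,b)`. -/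
noncomputable def ainftyQuot (w : ℝ → ℝ) (a b : ℝ) : ℝ :=
  avgI w a b * Real.exp (-(avgI (fun x => Real.log (w x)) a b))

def ainftySet (w : ℝ → ℝ) : Set ℝ :=
  {r : ℝ | ∃ a b : ℝ, a < b ∧ r = ainftyQuot w a b}

/-- The `A_∞` constant `[w]_{A_∞}`. -/
noncomputable def ainftyConst (w : ℝ → ℝ) : ℝ := sSup (ainftySet w)

/-- `w` is an `A_∞(ℝ)` weight: nonnegative, locally integrable, finite `A_∞` constant. -/
def IsAinftyWeight (w : ℝ → ℝ) : Prop :=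
  (∀ x, 0 ≤ w x) ∧ MeasureTheory.LocallyIntegrable w MeasureTheory.volume ∧
    BddAbove (ainftySet w)

/-- `log⁺ t = max {1, log t}`. -/
noncomputable def logPlus (t : ℝ) : ℝ := max 1 (Real.log t)

theorem osc_nonneg (f : ℝ → ℝ) : 0 ≤ bmoNorm f := by
  apply Real.sSup_nonneg
  rintro r ⟨a, b, hab, rfl⟩
  unfold avgI
  apply mul_nonneg (inv_nonneg.2 (by linarith))
  exact intervalIntegral.integral_nonneg hab.le (fun _ _ => abs_nonneg _)

theorem avgI_symm (f : ℝ → ℝ) (a b : ℝ) : avgI f a b = avgI f b a := by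
  unfold avgI
  rw [intervalIntegral.integral_symm, ← neg_sub b a, inv_neg]
  ring

theorem osc_le (f : ℝ → ℝ) (hf : MemBMO f) (a b : ℝ) (hab : a ≠ b) :
    avgI (fun x => |f x - avgI f a b|) a b ≤ bmoNorm f := by
  rcases lt_or_gt_of_ne hab with h | h
  · exact le_csSup hf.2 ⟨a, b, h, rfl⟩
  · rw [avgI_symm _ a b, avgI_symm f a b]
    exact le_csSup hf.2 ⟨b, a, h, rfl⟩

theorem avg_double (f : ℝ → ℝ) (hf : MemBMO f) (a : ℝ) (ha : a ≠ 0) :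
    |avgI f 0 a - avgI f 0 (2 * a)| ≤ 2 * bmoNorm f := by
  have hi : ∀ u v : ℝ, IntervalIntegrable f volume u v := fun u v =>
    (hf.1.integrableOn_isCompact isCompact_uIcc).intervalIntegrable
  set c := avgI f 0 (2 * a) with hc
  have h1 := osc_le f hf 0 (2 * a) (by intro h; apply ha; linarith)
  rw [← hc] at h1
  have hI : ∀ u v : ℝ, IntervalIntegrable (fun x => f x - c) volume u v := fun u v =>
    (hi u v).sub intervalIntegrable_const
  have h2 : ∫ x in (0:ℝ)..a, (f x - c) = a * (avgI f 0 a - c) := by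
    rw [intervalIntegral.integral_sub (hi _ _) intervalIntegrable_const]
    unfold avgI
    simp only [intervalIntegral.integral_const, sub_zero, smul_eq_mul]
    field_simp
  have h3 : |∫ x in (0:ℝ)..a, (f x - c)| ≤ |∫ x in (0:ℝ)..a, abs (f x - c)| :=
    intervalIntegral.norm_integral_le_abs_integral_norm (f := fun x => f x - c)
  have hsub : uIoc (0:ℝ) a ⊆ uIoc (0:ℝ) (2 * a) := by
    intro x hx
    rw [mem_uIoc] at *
    rcases hx with hx | hx
    · left; constructor <;> linarith
    · right; constructor <;> linarith
  have h4 : |∫ x in (0:ℝ)..a, abs (f x - c)| ≤ |∫ x in (0:ℝ)..(2*a), abs (f x - c)| :=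
    intervalIntegral.abs_integral_mono_interval hsub
      (Filter.Eventually.of_forall fun _ => abs_nonneg _) (hI _ _).abs
  have h5 : ∫ x in (0:ℝ)..(2*a), |f x - c| =
      (2 * a) * avgI (fun x => |f x - c|) 0 (2 * a) := by
    unfold avgI
    rw [sub_zero]
    field_simp
  have h6 : 0 ≤ avgI (fun x => |f x - c|) 0 (2 * a) := by
    rcases lt_or_gt_of_ne ha with h | h
    · rw [avgI_symm]
      exact mul_nonneg (inv_nonneg.2 (by linarith))
        (intervalIntegral.integral_nonneg (by linarith) (fun _ _ => abs_nonneg _))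
    · exact mul_nonneg (inv_nonneg.2 (by linarith))
        (intervalIntegral.integral_nonneg (by linarith) (fun _ _ => abs_nonneg _))
  have hap : 0 < |a| := abs_pos.2 ha
  rw [h5, abs_mul, abs_mul, abs_of_nonneg h6, abs_two] at h4
  rw [h2, abs_mul] at h3
  have h7 := h3.trans h4
  have h8 : |avgI f 0 a - c| ≤ 2 * avgI (fun x => |f x - c|) 0 (2 * a) := by
    apply le_of_mul_le_mul_left _ hap
    linarith
  linarith

theorem int_small (f : ℝ → ℝ) (hf : MemBMO f) (x : ℝ) (hx : |x| ≤ 1) :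
    |∫ z in (0:ℝ)..x, f z| ≤ ∫ z in (-1:ℝ)..1, |f z| := by
  have hi : ∀ u v : ℝ, IntervalIntegrable f volume u v := fun u v =>
    (hf.1.integrableOn_isCompact isCompact_uIcc).intervalIntegrable
  have h0 : 0 ≤ ∫ z in (-1:ℝ)..1, |f z| :=
    intervalIntegral.integral_nonneg (by norm_num) (fun _ _ => abs_nonneg _)
  have h3 : |∫ z in (0:ℝ)..x, f z| ≤ |∫ z in (0:ℝ)..x, abs (f z)| :=
    intervalIntegral.norm_integral_le_abs_integral_norm (f := f)
  refine h3.trans ?_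
  rw [← abs_of_nonneg h0]
  have := abs_le.1 hx
  apply intervalIntegral.abs_integral_mono_interval _
      (Filter.Eventually.of_forall fun _ => abs_nonneg _) (hi _ _).abs
  intro y hy
  rw [mem_uIoc] at *
  rcases hy with hy | hy
  · left; constructor <;> linarith
  · left; constructor <;> linarith

theorem avg_bound (f : ℝ → ℝ) (hf : MemBMO f) (n : ℕ) : ∀ x : ℝ, 1 / 2 < |x| → |x| ≤ 2 ^ n →
    |avgI f 0 x| ≤ 2 * (∫ z in (-1:ℝ)..1, |f z|) + 2 * n * bmoNorm f := by
  induction n with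
  | zero =>
    intro x h1 h2
    have h := int_small f hf x (by simpa using h2)
    unfold avgI
    rw [abs_mul, abs_inv, sub_zero]
    have h3 : |x|⁻¹ ≤ 2 := by
      rw [inv_le_comm₀ (by linarith) (by norm_num)]; linarith
    have := mul_le_mul h3 h (abs_nonneg _) (by norm_num)
    simpa using this
  | succ n ih =>
    intro x h1 h2
    have hN := osc_nonneg f
    push_cast
    by_cases h : |x| ≤ 2 ^ n
    · have := ih x h1 h
      linarith
    · have h3 : |x / 2| = |x| / 2 := by rw [abs_div, abs_two]
      have hp : (1:ℝ) ≤ 2 ^ n := one_le_pow₀ (by norm_num)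
      have h4 := ih (x / 2) (by rw [h3]; linarith) (by rw [h3]; rw [pow_succ] at h2; linarith)
      have h5 := avg_double f hf (x / 2) (by
        intro h0; rw [h0, abs_zero] at h3; linarith)
      rw [mul_div_cancel₀ x (two_ne_zero)] at h5
      have h6 := abs_sub_abs_le_abs_sub (avgI f 0 x) (avgI f 0 (x / 2))
      rw [abs_sub_comm] at h6
      linarith

/-- Linear-log growth bound: `|b(x)|/(1 + |x| log⁺|x|) ≤ |b(0)| + C ‖b'‖_*` for `b` locally
absolutely continuous with derivative `b' ∈ BMO(ℝ)`. -/
theorem sublinear_growth_of_bmo_deriv :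
    ∃ C : ℝ, 0 < C ∧
      ∀ b b' : ℝ → ℝ,
        MeasureTheory.LocallyIntegrable b MeasureTheory.volume →
        MemBMO b' →
        (∀ x y : ℝ, b y - b x = ∫ z in x..y, b' z) →
        ∀ x : ℝ, |b x| / (1 + |x| * logPlus |x|) ≤ |b 0| + C * starNorm b' := by
  refine ⟨10, by norm_num, ?_⟩
  intro b b' _ hf hb x
  have hN := osc_nonneg b'
  have h0 : 0 ≤ ∫ z in (-1:ℝ)..1, |b' z| :=
    intervalIntegral.integral_nonneg (by norm_num) (fun _ _ => abs_nonneg _)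
  have hL : 1 ≤ logPlus |x| := le_max_left _ _
  have hL' : Real.log |x| ≤ logPlus |x| := le_max_right _ _
  have hxL : 0 ≤ |x| * logPlus |x| := by positivity
  have hbx : |b x| ≤ |b 0| + |∫ z in (0:ℝ)..x, b' z| := by
    rw [← hb 0 x]
    have := abs_add_le (b 0) (b x - b 0)
    simpa using this
  rw [div_le_iff₀ (by linarith)]
  have key : |∫ z in (0:ℝ)..x, b' z| ≤ 10 * starNorm b' * (1 + |x| * logPlus |x|) := by
    unfold starNorm
    set I := ∫ z in (-1:ℝ)..1, |b' z|
    set N := bmoNorm b'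
    by_cases hx : |x| ≤ 1
    · have := int_small b' hf x hx
      nlinarith [mul_nonneg (add_nonneg hN h0) hxL]
    · push Not at hx
      set n := ⌈Real.logb 2 |x|⌉₊ with hn
      have hlb : 0 ≤ Real.logb 2 |x| := Real.logb_nonneg (by norm_num) hx.le
      have h1 : (n:ℝ) < Real.logb 2 |x| + 1 := Nat.ceil_lt_add_one hlb
      have h2 : |x| ≤ 2 ^ n := by
        rw [← Real.rpow_natCast, ← Real.logb_le_iff_le_rpow (by norm_num) (by linarith)]
        exact Nat.le_ceil _
      have h3 := avg_bound b' hf n x (by linarith) h2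
      have h4 : Real.logb 2 |x| ≤ 2 * Real.log |x| := by
        unfold Real.logb
        have := Real.log_two_gt_d9
        rw [div_le_iff₀ (by linarith)]
        have := Real.log_nonneg hx.le
        nlinarith
      have h5 : (n:ℝ) ≤ 3 * logPlus |x| := by linarith
      have h6 : |∫ z in (0:ℝ)..x, b' z| = |x| * |avgI b' 0 x| := by
        rw [← abs_mul]
        unfold avgI
        have : x ≠ 0 := by intro h; rw [h, abs_zero] at hx; linarith
        rw [sub_zero, mul_inv_cancel_left₀ this]
      rw [h6]
      have h7 : |avgI b' 0 x| ≤ 10 * (N + I) * logPlus |x| := by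
        have a1 := mul_le_mul_of_nonneg_right h5 hN
        have a2 := mul_le_mul_of_nonneg_left hL h0
        have a3 := mul_le_mul_of_nonneg_left hL hN
        linarith
      have h8 := mul_le_mul_of_nonneg_left h7 (abs_nonneg x)
      linarith
  have := mul_nonneg (abs_nonneg (b 0)) hxL
  linarith
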